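/- Let n ≥ 0 and let w : ℝ → ℝ^(n+1) be a differentiable curve with w(t) ≠ 0 for all t; set γ(t) = w(t)/‖w(t)‖ (Euclidean norm). Let g = (g₀, …, gₙ) be a vector of independent standard normal real random variables. Then for every measurable set I ⊆ ℝ, the expected number of solutions t ∈ I of the equation g₀·w₀(t) + g₁·w₁(t) + ⋯ + gₙ·wₙ(t) = 0 equals (1/π) ∫_I ‖γ′(t)‖ dt. (Theorem 3.1; the case of a general centered multivariate normal coefficient vector with covariance C reduces to this by taking w = C^(1/2)·v.) -/

import Mathlib

open MeasureTheory ProbabilityTheory Real Set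
open scoped ENNReal NNReal

section AreaFormula

variable {E : Type*} [NormedAddCommGroup E] [NormedSpace ℝ E] [FiniteDimensional ℝ E]
  [MeasurableSpace E] [BorelSpace E]

/-- A set on which `f` has everywhere invertible derivative is covered by countably many disjoint
measurable sets on which `f` is injective. -/
theorem exists_partition_injOn_of_det_ne_zero {f : E → E} {s : Set E} {f' : E → E →L[ℝ] E}
    (hf' : ∀ x ∈ s, HasFDerivWithinAt f (f' x) s x) (hdet : ∀ x ∈ s, (f' x).det ≠ 0) :
    ∃ t : ℕ → Set E, Pairwise (Function.onFun Disjoint t) ∧ (∀ k, MeasurableSet (t k)) ∧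
      s ⊆ ⋃ k, t k ∧ ∀ k, InjOn f (s ∩ t k) := by
  rcases s.eq_empty_or_nonempty with rfl | hne
  · refine ⟨fun _ => ∅, fun _ _ _ => by simp [Function.onFun], by simp, by simp, by simp⟩
  have key : ∀ A : E →L[ℝ] E, ∃ r : ℝ≥0, r ≠ 0 ∧ (A.det ≠ 0 → ∀ u : Set E,
      ApproximatesLinearOn f A u r → InjOn f u) := by
    intro A
    by_cases hA : A.det = 0
    · exact ⟨1, one_ne_zero, fun h => absurd hA h⟩
    let B : E ≃L[ℝ] E := A.toContinuousLinearEquivOfDetNeZero hA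
    rcases subsingleton_or_nontrivial E with hE | hE
    · exact ⟨1, one_ne_zero, fun _ u _ => injOn_of_injective (Function.injective_of_subsingleton f)⟩
    have hpos : 0 < ‖(B.symm : E →L[ℝ] E)‖₊⁻¹ := by
      have := B.nnnorm_symm_pos
      positivity
    refine ⟨‖(B.symm : E →L[ℝ] E)‖₊⁻¹ / 2, (half_pos hpos).ne', fun _ u hu => ?_⟩
    have hu' : ApproximatesLinearOn f (B : E →L[ℝ] E) u (‖(B.symm : E →L[ℝ] E)‖₊⁻¹ / 2) := hu
    exact hu'.injOn (Or.inr (half_lt_self hpos))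
  choose r hr0 hr using key
  obtain ⟨t, A, htd, htm, hst, happ, hA⟩ :=
    exists_partition_approximatesLinearOn_of_hasFDerivWithinAt f s f' hf' r hr0
  refine ⟨t, htd, htm, hst, fun k => hr (A k) ?_ _ (happ k)⟩
  obtain ⟨y, hy, hAy⟩ := hA hne k
  rw [hAy]
  exact hdet y hy

theorem encard_inter_preimage_singleton_of_injOn {α β : Type*} {f : α → β} {s : Set α}
    (hf : InjOn f s) (y : β) :
    ((s ∩ f ⁻¹' {y}).encard : ℝ≥0∞) = (f '' s).indicator 1 y := by
  by_cases hy : y ∈ f '' s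
  · obtain ⟨x, hx, rfl⟩ := hy
    have : s ∩ f ⁻¹' {f x} = {x} := by
      ext z
      simp only [mem_inter_iff, mem_preimage, mem_singleton_iff]
      exact ⟨fun h => hf h.1 hx h.2, by rintro rfl; exact ⟨hx, rfl⟩⟩
    rw [this, indicator_of_mem (mem_image_of_mem f hx)]
    simp
  · have : s ∩ f ⁻¹' {y} = ∅ := by
      ext z
      simp only [mem_inter_iff, mem_preimage, mem_singleton_iff, mem_empty_iff_false, iff_false]
      exact fun h => hy ⟨z, h.1, h.2⟩
    rw [this, indicator_of_notMem hy]
    simp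

/-- The fiber-counting function of a differentiable map is a.e. measurable, and it satisfies the
area formula. -/
theorem aemeasurable_encard_fiber_and_lintegral_mul_encard_fiber (μ : Measure E) [μ.IsAddHaarMeasure]
    {f : E → E} {s : Set E} {f' : E → E →L[ℝ] E} (hs : MeasurableSet s) (hf : Measurable f)
    (hf' : ∀ x ∈ s, HasFDerivWithinAt f (f' x) s x) (hdet : Measurable fun x => (f' x).det) :
    AEMeasurable (fun y => ((s ∩ f ⁻¹' {y}).encard : ℝ≥0∞)) μ ∧
      ∀ φ : E → ℝ≥0∞, Measurable φ →
        ∫⁻ y, φ y * ((s ∩ f ⁻¹' {y}).encard : ℝ≥0∞) ∂μ =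
          ∫⁻ x in s, ENNReal.ofReal |(f' x).det| * φ (f x) ∂μ := by
  set z : Set E := {x | (f' x).det = 0} with hz
  have hzm : MeasurableSet z := hdet (measurableSet_singleton 0)
  obtain ⟨t, htd, htm, hst, hinj⟩ :=
    exists_partition_injOn_of_det_ne_zero (f := f) (s := s \ z) (f' := f')
      (fun x hx => (hf' x hx.1).mono sdiff_subset) (fun x hx => hx.2)
  set p : ℕ → Set E := fun k => (s \ z) ∩ t k with hp
  have hpm : ∀ k, MeasurableSet (p k) := fun k => (hs.diff hzm).inter (htm k)
  have hpd : Pairwise (Function.onFun Disjoint p) := fun i j hij =>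
    (htd hij).mono inter_subset_right inter_subset_right
  have hpU : ⋃ k, p k = s \ z := by
    rw [hp, ← inter_iUnion, inter_eq_left]
    exact hst
  have hpf : ∀ k, ∀ x ∈ p k, HasFDerivWithinAt f (f' x) (p k) x := fun k x hx =>
    (hf' x hx.1.1).mono fun _ h => h.1.1
  have him : ∀ k, MeasurableSet (f '' p k) := fun k =>
    measurable_image_of_fderivWithin (hpm k) (hpf k) (hinj k)
  have hnull : μ (f '' (s ∩ z)) = 0 :=
    addHaar_image_eq_zero_of_det_fderivWithin_eq_zero μ (f' := f')
      (fun x hx => (hf' x hx.1).mono inter_subset_left) (fun x hx => hx.2)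
  have hae : (fun y => ((s ∩ f ⁻¹' {y}).encard : ℝ≥0∞)) =ᵐ[μ]
      fun y => ∑' k, (f '' p k).indicator 1 y := by
    filter_upwards [measure_eq_zero_iff_ae_notMem.1 hnull] with y hy
    have hfib : s ∩ f ⁻¹' {y} = ⋃ k, (p k ∩ f ⁻¹' {y}) := by
      rw [← iUnion_inter, hpU]
      ext x
      simp only [mem_inter_iff, mem_preimage, mem_singleton_iff, mem_sdiff]
      exact ⟨fun h => ⟨⟨h.1, fun hxz => hy ⟨x, ⟨h.1, hxz⟩, h.2⟩⟩, h.2⟩, fun h => ⟨h.1.1, h.2⟩⟩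
    have hfm : MeasurableSet (f ⁻¹' {y}) := hf (measurableSet_singleton y)
    rw [← Measure.count_apply (hs.inter hfm), hfib,
      measure_iUnion (fun i j hij => (hpd hij).mono inter_subset_left inter_subset_left)
        (fun k => (hpm k).inter hfm)]
    refine tsum_congr fun k => ?_
    rw [Measure.count_apply ((hpm k).inter hfm), encard_inter_preimage_singleton_of_injOn (hinj k)]
  refine ⟨(Measurable.tsum fun k => measurable_one.indicator (him k)).aemeasurable.congr
    hae.symm, fun φ hφ => ?_⟩
  have hzero : ∫⁻ x in s ∩ z, ENNReal.ofReal |(f' x).det| * φ (f x) ∂μ = 0 := by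
    rw [setLIntegral_congr_fun (g := fun _ => 0) (hs.inter hzm)
      (fun x hx => by simp [show (f' x).det = 0 from hx.2])]
    simp
  calc ∫⁻ y, φ y * ((s ∩ f ⁻¹' {y}).encard : ℝ≥0∞) ∂μ
      = ∫⁻ y, ∑' k, (f '' p k).indicator φ y ∂μ := by
        refine lintegral_congr_ae ?_
        filter_upwards [hae] with y hy
        rw [hy, ← ENNReal.tsum_mul_left]
        refine tsum_congr fun k => ?_
        by_cases h : y ∈ f '' p k <;> simp [h]
    _ = ∑' k, ∫⁻ y in f '' p k, φ y ∂μ := by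
        rw [lintegral_tsum fun k => (hφ.indicator (him k)).aemeasurable]
        exact tsum_congr fun k => lintegral_indicator (him k) φ
    _ = ∑' k, ∫⁻ x in p k, ENNReal.ofReal |(f' x).det| * φ (f x) ∂μ :=
        tsum_congr fun k =>
          lintegral_image_eq_lintegral_abs_det_fderiv_mul μ (hpm k) (hpf k) (hinj k) φ
    _ = ∫⁻ x in s \ z, ENNReal.ofReal |(f' x).det| * φ (f x) ∂μ := by
        rw [← lintegral_iUnion hpm hpd, hpU]
    _ = ∫⁻ x in s, ENNReal.ofReal |(f' x).det| * φ (f x) ∂μ := by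
        rw [← lintegral_inter_add_sdiff _ s hzm, hzero, zero_add]

end AreaFormula

section GaussianComputations

/-- The first absolute moment of a centered real Gaussian. -/
theorem lintegral_ofReal_abs_gaussianReal (v : ℝ≥0) :
    ∫⁻ x, ENNReal.ofReal |x| ∂(gaussianReal 0 v) = ENNReal.ofReal (√(2 * v / π)) := by
  rcases eq_or_ne v 0 with rfl | hv
  · simp
  have hv' : (0 : ℝ) < v := by exact_mod_cast pos_iff_ne_zero.2 hv
  have hb : (0 : ℝ) < (2 * v)⁻¹ := by positivity
  have hform : ∀ x : ℝ, gaussianPDFReal 0 v x * |x| =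
      (√(2 * π * v))⁻¹ * (|x| * rexp (-(2 * v : ℝ)⁻¹ * |x| ^ 2)) := by
    intro x
    rw [gaussianPDFReal, sq_abs, sub_zero]
    rw [show -x ^ 2 / (2 * (v : ℝ)) = -(2 * v : ℝ)⁻¹ * x ^ 2 by ring]
    ring
  have hint : Integrable (fun x : ℝ => gaussianPDFReal 0 v x * |x|) := by
    simp_rw [hform]
    refine Integrable.const_mul ?_ _
    refine (integrable_mul_exp_neg_mul_sq hb).norm.congr (ae_of_all _ fun x => ?_)
    simp
  have hIoi : ∫ x in Ioi (0 : ℝ), x * rexp (-(2 * v : ℝ)⁻¹ * x ^ 2) = v := by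
    have := integral_rpow_mul_exp_neg_mul_rpow (p := 2) (q := 1) (b := (2 * v : ℝ)⁻¹)
      (by norm_num) (by norm_num) hb
    norm_num at this
    norm_num
    rw [this, rpow_neg_one]
    field_simp
  rw [gaussianReal_of_var_ne_zero _ hv, lintegral_withDensity_eq_lintegral_mul _
    (measurable_gaussianPDF _ _) (by fun_prop)]
  simp_rw [Pi.mul_apply, gaussianPDF, ← ENNReal.ofReal_mul (gaussianPDFReal_nonneg _ _ _)]
  rw [← ofReal_integral_eq_lintegral_ofReal hint
    (ae_of_all _ fun x => mul_nonneg (gaussianPDFReal_nonneg _ _ _) (abs_nonneg x))]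
  congr 1
  simp_rw [hform]
  rw [integral_const_mul, integral_comp_abs (f := fun x => x * rexp (-(2 * v : ℝ)⁻¹ * x ^ 2)),
    hIoi]
  rw [show 2 * π * (v : ℝ) = 2 * v * π by ring, eq_comm,
    sqrt_eq_iff_mul_self_eq (by positivity) (by positivity)]
  have : √(2 * v * π) ≠ 0 := by positivity
  field_simp
  rw [sq_sqrt (by positivity)]

/-- Weighting a centered Gaussian by the standard Gaussian density gives a multiple of a centered
Gaussian. -/
theorem gaussianReal_withDensity_gaussianPDF (s : ℝ≥0) :
    (gaussianReal 0 s).withDensity (gaussianPDF 0 1) =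
      ENNReal.ofReal (√(2 * π * (1 + s)))⁻¹ • gaussianReal 0 (s / (1 + s)) := by
  rcases eq_or_ne s 0 with rfl | hs
  · rw [zero_div, gaussianReal_zero_var]
    ext u hu
    rw [withDensity_apply _ hu]
    classical
    rw [setLIntegral_dirac]
    by_cases h0 : (0 : ℝ) ∈ u <;> simp [h0, gaussianPDF, gaussianPDFReal, hu]
  have hs' : (0 : ℝ) < s := by exact_mod_cast pos_iff_ne_zero.2 hs
  rw [gaussianReal_of_var_ne_zero _ hs, gaussianReal_of_var_ne_zero _ (by positivity),
    ← withDensity_mul _ (measurable_gaussianPDF _ _) (measurable_gaussianPDF _ _),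
    ← withDensity_smul _ (measurable_gaussianPDF _ _)]
  congr 1
  ext x
  simp only [Pi.mul_apply, Pi.smul_apply, smul_eq_mul, gaussianPDF]
  rw [← ENNReal.ofReal_mul (gaussianPDFReal_nonneg _ _ _), ← ENNReal.ofReal_mul (by positivity)]
  congr 1
  simp only [gaussianPDFReal, sub_zero, NNReal.coe_one, NNReal.coe_div, NNReal.coe_add, mul_one]
  rw [mul_mul_mul_comm, ← exp_add, ← mul_inv, ← mul_assoc, ← mul_inv, ← sqrt_mul (by positivity),
    ← sqrt_mul (by positivity)]
  congr 2
  · congr 1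
    field_simp
  · field_simp
    ring

variable {E : Type*} [NormedAddCommGroup E] [InnerProductSpace ℝ E] [FiniteDimensional ℝ E]
  [MeasurableSpace E] [BorelSpace E]

theorem stdGaussian_map_inner (x : E) :
    (stdGaussian E).map (fun a => inner ℝ x a) = gaussianReal 0 (‖x‖₊ ^ 2) := by
  have h := IsGaussian.map_eq_gaussianReal (μ := stdGaussian E) (innerSL ℝ x)
  rw [integral_strongDual_stdGaussian, variance_dual_stdGaussian] at h
  simp only [innerSL_apply_norm] at h
  rw [Real.toNNReal_pow (norm_nonneg x), norm_toNNReal] at h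
  exact h

theorem stdGaussian_map_inner_prod {x z : E} (hxz : inner ℝ x z = 0) :
    (stdGaussian E).map (fun a => (inner ℝ x a, inner ℝ z a)) =
      (gaussianReal 0 (‖x‖₊ ^ 2)).prod (gaussianReal 0 (‖z‖₊ ^ 2)) := by
  have hg : HasGaussianLaw (fun a : E => (inner ℝ x a, inner ℝ z a)) (stdGaussian E) :=
    IsGaussian.hasGaussianLaw_id.map_fun ((innerSL ℝ x).prod (innerSL ℝ z))
  have hcov : cov[fun a : E => inner ℝ x a, fun a : E => inner ℝ z a; stdGaussian E] = 0 := by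
    have := covarianceBilin_apply_eq_cov (μ := stdGaussian E) IsGaussian.memLp_two_id x z
    rw [← this, covarianceBilin_stdGaussian]
    simpa using! hxz
  have hind := hg.indepFun_of_covariance_eq_zero hcov
  rw [indepFun_iff_map_prod_eq_prod_map_map (by fun_prop) (by fun_prop)] at hind
  rw [hind, stdGaussian_map_inner, stdGaussian_map_inner]

/-- The Gaussian integral computing the Kac–Rice density. -/
theorem lintegral_gaussianPDF_inner_mul_abs_inner (x y : E) :
    ∫⁻ a, gaussianPDF 0 1 (inner ℝ x a) * ENNReal.ofReal |inner ℝ y a| ∂(stdGaussian E) =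
      ENNReal.ofReal (√(‖y‖ ^ 2 - inner ℝ x y ^ 2 / (1 + ‖x‖ ^ 2)) / √(1 + ‖x‖ ^ 2) / π) := by
  set β : ℝ := inner ℝ x y / ‖x‖ ^ 2 with hβ
  set z : E := y - β • x with hz
  have hβx : β * ‖x‖ ^ 2 = inner ℝ x y := by
    rcases eq_or_ne x 0 with rfl | hx
    · simp
    · have : ‖x‖ ≠ 0 := norm_ne_zero_iff.2 hx
      rw [hβ]
      field_simp
  have hxz : inner ℝ x z = 0 := by
    rw [hz, inner_sub_right, inner_smul_right, real_inner_self_eq_norm_sq, hβx, sub_self]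
  have hy : ∀ a, inner ℝ y a = β * inner ℝ x a + inner ℝ z a := by
    intro a
    rw [hz, inner_sub_left, real_inner_smul_left]
    ring
  have hzn : ‖z‖ ^ 2 = ‖y‖ ^ 2 - β ^ 2 * ‖x‖ ^ 2 := by
    have : ‖y‖ ^ 2 = ‖β • x + z‖ ^ 2 := by rw [hz]; congr 2; abel
    rw [this, norm_add_sq_real, real_inner_smul_left, hxz, norm_smul, mul_pow, norm_eq_abs, sq_abs]
    ring
  set s : ℝ≥0 := ‖x‖₊ ^ 2 with hs
  set r : ℝ≥0 := ‖z‖₊ ^ 2 with hr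
  have hF : Measurable fun q : ℝ × ℝ => gaussianPDF 0 1 q.1 * ENNReal.ofReal |β * q.1 + q.2| :=
    ((measurable_gaussianPDF 0 1).comp measurable_fst).mul (by fun_prop)
  calc ∫⁻ a, gaussianPDF 0 1 (inner ℝ x a) * ENNReal.ofReal |inner ℝ y a| ∂(stdGaussian E)
      = ∫⁻ q, gaussianPDF 0 1 q.1 * ENNReal.ofReal |β * q.1 + q.2|
          ∂((gaussianReal 0 s).prod (gaussianReal 0 r)) := by
        rw [← stdGaussian_map_inner_prod hxz, lintegral_map hF (by fun_prop)]
        simp_rw [hy]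
    _ = ∫⁻ t, gaussianPDF 0 1 t * ∫⁻ u, ENNReal.ofReal |β * t + u| ∂(gaussianReal 0 r)
          ∂(gaussianReal 0 s) := by
        rw [lintegral_prod _ hF.aemeasurable]
        refine lintegral_congr fun t => ?_
        exact lintegral_const_mul (gaussianPDF 0 1 t)
          (f := fun u => ENNReal.ofReal |β * t + u|) (by fun_prop)
    _ = ENNReal.ofReal (√(2 * π * (1 + s)))⁻¹ *
          ∫⁻ t, ∫⁻ u, ENNReal.ofReal |β * t + u| ∂(gaussianReal 0 r)
            ∂(gaussianReal 0 (s / (1 + s))) := by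
        have hm : Measurable fun t => ∫⁻ u, ENNReal.ofReal |β * t + u| ∂(gaussianReal 0 r) :=
          Measurable.lintegral_prod_right' (f := fun q : ℝ × ℝ => ENNReal.ofReal |β * q.1 + q.2|)
            (by fun_prop)
        rw [← smul_eq_mul, ← lintegral_smul_measure, ← gaussianReal_withDensity_gaussianPDF,
          lintegral_withDensity_eq_lintegral_mul _ (measurable_gaussianPDF _ _) hm]
        rfl
    _ = ENNReal.ofReal (√(2 * π * (1 + s)))⁻¹ *
          ∫⁻ u, ENNReal.ofReal |u|
            ∂(gaussianReal 0 (NNReal.mk (β ^ 2) (sq_nonneg β) * (s / (1 + s)) + r)) := by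
        have := gaussianReal_conv_gaussianReal (m₁ := β * 0) (m₂ := 0)
          (v₁ := NNReal.mk (β ^ 2) (sq_nonneg β) * (s / (1 + s))) (v₂ := r)
        rw [mul_zero, zero_add] at this
        rw [← this, Measure.lintegral_conv (by fun_prop)]
        have hmap := gaussianReal_map_const_mul (μ := 0) (v := s / (1 + s)) β
        rw [mul_zero] at hmap
        rw [← hmap, lintegral_map ?_ (by fun_prop)]
        exact Measurable.lintegral_prod_right' (f := fun q : ℝ × ℝ => ENNReal.ofReal |q.1 + q.2|)
            (by fun_prop)
    _ = _ := by
        rw [lintegral_ofReal_abs_gaussianReal, ← ENNReal.ofReal_mul (by positivity)]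
        congr 1
        have hv : ((NNReal.mk (β ^ 2) (sq_nonneg β) * (s / (1 + s)) + r : ℝ≥0) : ℝ) =
            ‖y‖ ^ 2 - inner ℝ x y ^ 2 / (1 + ‖x‖ ^ 2) := by
          simp only [hs, hr, NNReal.coe_add, NNReal.coe_mul, NNReal.coe_mk, NNReal.coe_div,
            NNReal.coe_pow, coe_nnnorm, NNReal.coe_one]
          rw [hzn, ← hβx]
          have : 1 + ‖x‖ ^ 2 ≠ 0 := by positivity
          field_simp
          ring
        rw [hv]
        have hsx : (s : ℝ) = ‖x‖ ^ 2 := by simp [hs]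
        rw [hsx, sqrt_div' _ pi_pos.le, sqrt_mul zero_le_two, sqrt_mul (by positivity),
          sqrt_mul zero_le_two]
        have h2 : √(2 : ℝ) ≠ 0 := by positivity
        have hp := mul_self_sqrt pi_pos.le
        have hp' : √π ≠ 0 := by positivity
        have h1 : √(1 + ‖x‖ ^ 2) ≠ 0 := by positivity
        nth_rw 3 [← hp]
        field_simp

end GaussianComputations

section LinearZeros

theorem pi_absolutelyContinuous_volume (μ : Measure ℝ) [SigmaFinite μ] (hμ : μ ≪ volume) (n : ℕ) :
    Measure.pi (fun _ : Fin n => μ) ≪ volume := by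
  induction n with
  | zero => rw [volume_pi, Measure.pi_of_empty, Measure.pi_of_empty]
  | succ n ih =>
    have h1 := (measurePreserving_piFinSuccAbove (fun _ : Fin (n + 1) => μ) 0).symm
    have h2 := (measurePreserving_piFinSuccAbove
      (fun _ : Fin (n + 1) => (volume : Measure ℝ)) 0).symm
    rw [volume_pi, ← h1.map_eq, ← h2.map_eq]
    exact (hμ.prod ih).map (MeasurableEquiv.measurable _)

theorem exists_measurable_density_pi_gaussianReal (n : ℕ) :
    ∃ ρ : (Fin n → ℝ) → ℝ≥0∞, Measurable ρ ∧
      Measure.pi (fun _ : Fin n => gaussianReal 0 1) = volume.withDensity ρ :=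
  ⟨_, Measure.measurable_rnDeriv _ _, (Measure.withDensity_rnDeriv_eq _ _
    (pi_absolutelyContinuous_volume _ (gaussianReal_absolutelyContinuous 0 one_ne_zero) n)).symm⟩

variable {n : ℕ}

/-- For coefficient functions `c`, sends `(t, a)` to the pair of the unique `b` such that `t` solves
`b + ∑ j, a j * c j t = 0`, and `a`. -/
noncomputable def graphMap (c : Fin n → ℝ → ℝ) (q : ℝ × (Fin n → ℝ)) : ℝ × (Fin n → ℝ) :=
  (-∑ j, q.2 j * c j q.1, q.2)

/-- The derivative of `graphMap c`. -/
noncomputable def graphMapDeriv (c : Fin n → ℝ → ℝ) (q : ℝ × (Fin n → ℝ)) :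
    ℝ × (Fin n → ℝ) →L[ℝ] ℝ × (Fin n → ℝ) :=
  (-∑ j, (q.2 j • (deriv (c j) q.1 • ContinuousLinearMap.fst ℝ ℝ (Fin n → ℝ)) +
    c j q.1 • (ContinuousLinearMap.proj j ∘L ContinuousLinearMap.snd ℝ ℝ (Fin n → ℝ)))).prod
    (ContinuousLinearMap.snd ℝ ℝ (Fin n → ℝ))

theorem hasFDerivAt_graphMap {c : Fin n → ℝ → ℝ} {q : ℝ × (Fin n → ℝ)}
    (hc : ∀ j, DifferentiableAt ℝ (c j) q.1) :
    HasFDerivAt (graphMap c) (graphMapDeriv c q) q := by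
  refine HasFDerivAt.prodMk (HasFDerivAt.neg (HasFDerivAt.fun_sum fun j _ => ?_)) hasFDerivAt_snd
  have h1 : HasFDerivAt (fun q : ℝ × (Fin n → ℝ) => q.2 j)
      (ContinuousLinearMap.proj j ∘L ContinuousLinearMap.snd ℝ ℝ (Fin n → ℝ)) q :=
    (ContinuousLinearMap.proj j ∘L ContinuousLinearMap.snd ℝ ℝ (Fin n → ℝ)).hasFDerivAt
  have h2 : HasFDerivAt (fun q : ℝ × (Fin n → ℝ) => c j q.1)
      (deriv (c j) q.1 • ContinuousLinearMap.fst ℝ ℝ (Fin n → ℝ)) q :=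
    (hc j).hasDerivAt.comp_hasFDerivAt q hasFDerivAt_fst
  exact h1.mul h2

theorem det_graphMapDeriv (c : Fin n → ℝ → ℝ) (q : ℝ × (Fin n → ℝ)) :
    (graphMapDeriv c q).det = -∑ j, q.2 j * deriv (c j) q.1 := by
  let F : ℝ × (Fin n → ℝ) →ₗ[ℝ] ℝ :=
    LinearMap.fst ℝ ℝ (Fin n → ℝ) ∘ₗ (graphMapDeriv c q : _ →ₗ[ℝ] _) -
      LinearMap.fst ℝ ℝ (Fin n → ℝ)
  have h : (graphMapDeriv c q : _ →ₗ[ℝ] _) = LinearMap.transvection F (1, 0) := by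
    refine LinearMap.ext fun p => ?_
    refine Prod.ext ?_ ?_ <;> simp [F, LinearMap.transvection, graphMapDeriv]
  rw [ContinuousLinearMap.det, h, LinearMap.transvection.det]
  simp [F, graphMapDeriv]

theorem measurable_graphMap {c : Fin n → ℝ → ℝ} (hc : ∀ j, Measurable (c j)) :
    Measurable (graphMap c) := by
  unfold graphMap
  refine Measurable.prodMk (Measurable.neg (Finset.measurable_fun_sum _ fun j _ => ?_)) measurable_snd
  exact ((measurable_pi_apply j).comp measurable_snd).mul ((hc j).comp measurable_fst)

theorem measurable_det_graphMapDeriv (c : Fin n → ℝ → ℝ) :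
    Measurable fun q => (graphMapDeriv c q).det := by
  simp_rw [det_graphMapDeriv]
  refine Measurable.neg (Finset.measurable_fun_sum _ fun j _ => ?_)
  exact ((measurable_pi_apply j).comp measurable_snd).mul
    ((measurable_deriv (c j)).comp measurable_fst)

theorem encard_prod_univ_inter_preimage_graphMap (c : Fin n → ℝ → ℝ) (J : Set ℝ)
    (y : ℝ × (Fin n → ℝ)) :
    (J ×ˢ univ ∩ graphMap c ⁻¹' {y}).encard =
      {t | t ∈ J ∧ y.1 + ∑ j, y.2 j * c j t = 0}.encard := by
  have hinj : Function.Injective fun t : ℝ => (t, y.2) := fun _ _ h => (Prod.ext_iff.1 h).1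
  rw [← hinj.encard_image]
  congr 1
  ext ⟨t, a⟩
  simp only [graphMap, mem_inter_iff, mem_prod, mem_univ, and_true, mem_preimage,
    mem_singleton_iff, Prod.ext_iff, mem_image, mem_ofPred_eq]
  constructor
  · rintro ⟨ht, h, rfl⟩
    exact ⟨t, ⟨ht, by rw [← h]; ring⟩, rfl, rfl⟩
  · rintro ⟨t', ⟨ht', h⟩, rfl, rfl⟩
    exact ⟨ht', by linarith, rfl⟩

/-- Kac–Rice formula for the zeros of `b + ∑ j, a j * c j t` with standard Gaussian coefficients
`b` and `a`. -/
theorem aemeasurable_and_lintegral_encard_zeros_affine {c : Fin n → ℝ → ℝ}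
    (hcm : ∀ j, Measurable (c j)) {J : Set ℝ} (hJ : MeasurableSet J)
    (hc : ∀ t ∈ J, ∀ j, DifferentiableAt ℝ (c j) t) :
    AEMeasurable (fun y : ℝ × (Fin n → ℝ) =>
        ({t | t ∈ J ∧ y.1 + ∑ j, y.2 j * c j t = 0}.encard : ℝ≥0∞))
      ((gaussianReal 0 1).prod (Measure.pi fun _ : Fin n => gaussianReal 0 1)) ∧
    ∫⁻ y : ℝ × (Fin n → ℝ), ({t | t ∈ J ∧ y.1 + ∑ j, y.2 j * c j t = 0}.encard : ℝ≥0∞)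
        ∂((gaussianReal 0 1).prod (Measure.pi fun _ : Fin n => gaussianReal 0 1)) =
      ∫⁻ t in J, ∫⁻ a, gaussianPDF 0 1 (-∑ j, a j * c j t) *
        ENNReal.ofReal |∑ j, a j * deriv (c j) t| ∂(Measure.pi fun _ : Fin n => gaussianReal 0 1) := by
  obtain ⟨ρ, hρ, hpi⟩ := exists_measurable_density_pi_gaussianReal n
  have hφ : Measurable fun y : ℝ × (Fin n → ℝ) => gaussianPDF 0 1 y.1 * ρ y.2 :=
    ((measurable_gaussianPDF 0 1).comp measurable_fst).mul (hρ.comp measurable_snd)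
  have hprod : (gaussianReal 0 1).prod (Measure.pi fun _ : Fin n => gaussianReal 0 1) =
      ((volume : Measure ℝ).prod (volume : Measure (Fin n → ℝ))).withDensity
        fun y => gaussianPDF 0 1 y.1 * ρ y.2 := by
    rw [hpi, gaussianReal_of_var_ne_zero _ one_ne_zero,
      prod_withDensity (measurable_gaussianPDF 0 1) hρ]
  obtain ⟨hmeas, harea⟩ := aemeasurable_encard_fiber_and_lintegral_mul_encard_fiber
    ((volume : Measure ℝ).prod (volume : Measure (Fin n → ℝ)))
    (hJ.prod MeasurableSet.univ) (measurable_graphMap hcm)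
    (fun q hq => (hasFDerivAt_graphMap (hc q.1 hq.1)).hasFDerivWithinAt)
    (measurable_det_graphMapDeriv c)
  simp_rw [encard_prod_univ_inter_preimage_graphMap] at hmeas harea
  refine ⟨hmeas.mono_ac (hprod ▸ withDensity_absolutelyContinuous _ _), ?_⟩
  have hsum : ∀ d : Fin n → ℝ → ℝ, (∀ j, Measurable (d j)) →
      Measurable fun q : ℝ × (Fin n → ℝ) => ∑ j, q.2 j * d j q.1 := fun d hd =>
    Finset.measurable_fun_sum _ fun j _ =>
      ((measurable_pi_apply j).comp measurable_snd).mul ((hd j).comp measurable_fst)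
  have h1 := hsum c hcm
  have h2 := hsum (fun j => deriv (c j)) fun j => measurable_deriv _
  have hG : Measurable fun q : ℝ × (Fin n → ℝ) => gaussianPDF 0 1 (-∑ j, q.2 j * c j q.1) *
      ENNReal.ofReal |∑ j, q.2 j * deriv (c j) q.1| :=
    ((measurable_gaussianPDF 0 1).comp h1.neg).mul
      (ENNReal.measurable_ofReal.comp (measurable_norm.comp h2))
  rw [hprod, lintegral_withDensity_eq_lintegral_mul₀ hφ.aemeasurable hmeas]
  simp only [Pi.mul_apply]
  rw [harea _ hφ, ← Measure.prod_restrict, Measure.restrict_univ]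
  have hrw : ∀ q : ℝ × (Fin n → ℝ), ENNReal.ofReal |(graphMapDeriv c q).det| *
      (gaussianPDF 0 1 (graphMap c q).1 * ρ (graphMap c q).2) =
      ρ q.2 * (gaussianPDF 0 1 (-∑ j, q.2 j * c j q.1) *
        ENNReal.ofReal |∑ j, q.2 j * deriv (c j) q.1|) := by
    intro q
    rw [det_graphMapDeriv, abs_neg, graphMap]
    ring
  simp_rw [hrw]
  have hρG : Measurable fun q : ℝ × (Fin n → ℝ) => ρ q.2 *
      (gaussianPDF 0 1 (-∑ j, q.2 j * c j q.1) * ENNReal.ofReal |∑ j, q.2 j * deriv (c j) q.1|) :=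
    (hρ.comp measurable_snd).mul hG
  rw [lintegral_prod _ hρG.aemeasurable]
  refine lintegral_congr fun t => ?_
  rw [hpi]
  exact (lintegral_withDensity_eq_lintegral_mul _ hρ (hG.comp measurable_prodMk_left)).symm

/-- The inner Gaussian integral of the Kac–Rice formula. -/
theorem lintegral_pi_gaussianPDF_mul_abs (x y : Fin n → ℝ) :
    ∫⁻ a, gaussianPDF 0 1 (-∑ j, a j * x j) * ENNReal.ofReal |∑ j, a j * y j|
        ∂(Measure.pi fun _ : Fin n => gaussianReal 0 1) =
      ENNReal.ofReal (√(∑ j, y j ^ 2 - (∑ j, x j * y j) ^ 2 / (1 + ∑ j, x j ^ 2)) /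
        √(1 + ∑ j, x j ^ 2) / π) := by
  have h := lintegral_gaussianPDF_inner_mul_abs_inner (-WithLp.toLp 2 x : EuclideanSpace ℝ (Fin n))
    (WithLp.toLp 2 y)
  rw [← map_pi_eq_stdGaussian, lintegral_map ?_ (by fun_prop)] at h
  · simpa [PiLp.inner_apply, EuclideanSpace.real_norm_sq_eq, mul_comm] using h
  · exact ((measurable_gaussianPDF 0 1).comp (by fun_prop)).mul (by fun_prop)

end LinearZeros

section UnitCurve

theorem sqrt_div_sqrt_of_quotient {n : ℕ} {r r' S : ℝ} (hr : r ≠ 0) (u v : Fin n → ℝ)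
    (hu : ∑ j, u j ^ 2 = 1 - r ^ 2) (huv : ∑ j, u j * v j = -(r * r'))
    (hv : ∑ j, v j ^ 2 = S - r' ^ 2) :
    √(∑ j, ((v j * r - u j * r') / r ^ 2) ^ 2 -
        (∑ j, u j / r * ((v j * r - u j * r') / r ^ 2)) ^ 2 / (1 + ∑ j, (u j / r) ^ 2)) /
      √(1 + ∑ j, (u j / r) ^ 2) = √S := by
  have h1 : 1 + ∑ j, (u j / r) ^ 2 = 1 / r ^ 2 := by
    simp_rw [div_pow]
    rw [← Finset.sum_div, hu]
    field_simp
    ring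
  have h2 : ∑ j, u j / r * ((v j * r - u j * r') / r ^ 2) = -r' / r ^ 3 := by
    have : ∀ j, u j / r * ((v j * r - u j * r') / r ^ 2) =
        (u j * v j) * (1 / r ^ 2) - u j ^ 2 * (r' / r ^ 3) := fun j => by field_simp
    simp_rw [this]
    rw [Finset.sum_sub_distrib, ← Finset.sum_mul, ← Finset.sum_mul, hu, huv]
    field_simp
    ring
  have h3 : ∑ j, ((v j * r - u j * r') / r ^ 2) ^ 2 = (r ^ 2 * S + r' ^ 2) / r ^ 4 := by
    have : ∀ j, ((v j * r - u j * r') / r ^ 2) ^ 2 =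
        v j ^ 2 * (1 / r ^ 2) - (u j * v j) * (2 * r' / r ^ 3) + u j ^ 2 * (r' ^ 2 / r ^ 4) :=
      fun j => by field_simp; ring
    simp_rw [this]
    rw [Finset.sum_add_distrib, Finset.sum_sub_distrib, ← Finset.sum_mul, ← Finset.sum_mul,
      ← Finset.sum_mul, hu, huv, hv]
    field_simp
    ring
  rw [h1, h2, h3, ← Real.sqrt_div' _ (by positivity)]
  congr 1
  field_simp
  ring

/-- Kac–Rice formula for a curve on the unit sphere, on a set where one coordinate does not
vanish. -/
theorem aemeasurable_and_lintegral_encard_zeros_of_ne_zero {n : ℕ} {f : Fin (n + 1) → ℝ → ℝ}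
    (hf : ∀ k, Differentiable ℝ (f k)) (hf1 : ∀ t, ∑ k, f k t ^ 2 = 1)
    {J : Set ℝ} (hJ : MeasurableSet J) (i : Fin (n + 1)) (hi : ∀ t ∈ J, f i t ≠ 0) :
    AEMeasurable (fun g : Fin (n + 1) → ℝ =>
        ({t | t ∈ J ∧ ∑ k, g k * f k t = 0}.encard : ℝ≥0∞))
      (Measure.pi fun _ => gaussianReal 0 1) ∧
    ∫⁻ g : Fin (n + 1) → ℝ, ({t | t ∈ J ∧ ∑ k, g k * f k t = 0}.encard : ℝ≥0∞)
        ∂(Measure.pi fun _ => gaussianReal 0 1) =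
      ∫⁻ t in J, ENNReal.ofReal (√(∑ k, deriv (f k) t ^ 2) / π) := by
  let c : Fin n → ℝ → ℝ := fun j t => f (i.succAbove j) t / f i t
  have hcm : ∀ j, Measurable (c j) := fun j =>
    (hf _).continuous.measurable.div (hf i).continuous.measurable
  have hcd : ∀ t ∈ J, ∀ j, HasDerivAt (c j)
      ((deriv (f (i.succAbove j)) t * f i t - f (i.succAbove j) t * deriv (f i) t) / f i t ^ 2) t :=
    fun t ht j => (hf _ t).hasDerivAt.div (hf i t).hasDerivAt (hi t ht)
  obtain ⟨hmeas, hint⟩ := aemeasurable_and_lintegral_encard_zeros_affine hcm hJ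
    fun t ht j => (hcd t ht j).differentiableAt
  have hmp := measurePreserving_piFinSuccAbove (fun _ : Fin (n + 1) => gaussianReal 0 1) i
  have hset : ∀ g : Fin (n + 1) → ℝ, {t | t ∈ J ∧ ∑ k, g k * f k t = 0} =
      {t | t ∈ J ∧ (MeasurableEquiv.piFinSuccAbove (fun _ => ℝ) i g).1 +
        ∑ j, (MeasurableEquiv.piFinSuccAbove (fun _ => ℝ) i g).2 j * c j t = 0} := by
    intro g
    ext t
    refine and_congr_right fun ht => ?_
    have h : ∑ k, g k * f k t = f i t * (g i + ∑ j, g (i.succAbove j) * c j t) := by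
      rw [Fin.sum_univ_succAbove _ i, mul_add, Finset.mul_sum, mul_comm (g i)]
      congr 1
      refine Finset.sum_congr rfl fun j _ => ?_
      have := hi t ht
      simp only [c]
      field_simp
    rw [h, mul_eq_zero, or_iff_right (hi t ht)]
    rfl
  simp_rw [hset]
  refine ⟨hmeas.comp_quasiMeasurePreserving hmp.quasiMeasurePreserving, ?_⟩
  rw [hmp.lintegral_comp_emb (MeasurableEquiv.measurableEmbedding _)
    (fun y : ℝ × (Fin n → ℝ) => ({t | t ∈ J ∧ y.1 + ∑ j, y.2 j * c j t = 0}.encard : ℝ≥0∞)), hint]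
  refine setLIntegral_congr_fun hJ fun t ht => ?_
  have h1 := hf1 t
  have h2 : ∑ k, f k t * deriv (f k) t = 0 := by
    have h : HasDerivAt (fun t => ∑ k, f k t ^ 2) (∑ k, 2 * (f k t * deriv (f k) t)) t := by
      refine HasDerivAt.fun_sum fun k _ => ?_
      refine ((hf k t).hasDerivAt.fun_pow 2).congr_deriv ?_
      push_cast
      ring
    have h0 := h.unique ((funext hf1 : (fun t => ∑ k, f k t ^ 2) = _) ▸ hasDerivAt_const t 1)
    rw [← Finset.mul_sum] at h0
    linarith
  rw [Fin.sum_univ_succAbove _ i] at h1 h2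
  rw [lintegral_pi_gaussianPDF_mul_abs]
  simp_rw [fun j => (hcd t ht j).deriv]
  rw [sqrt_div_sqrt_of_quotient (hi t ht) (fun j => f (i.succAbove j) t)
    (fun j => deriv (f (i.succAbove j)) t) (by linarith) (by linarith)
    (S := ∑ k, deriv (f k) t ^ 2) (by rw [Fin.sum_univ_succAbove _ i]; ring)]

/-- Kac–Rice formula for a curve on the unit sphere. -/
theorem lintegral_encard_zeros_of_sum_sq_eq_one {n : ℕ} {f : Fin (n + 1) → ℝ → ℝ}
    (hf : ∀ k, Differentiable ℝ (f k)) (hf1 : ∀ t, ∑ k, f k t ^ 2 = 1)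
    {I : Set ℝ} (hI : MeasurableSet I) :
    ∫⁻ g : Fin (n + 1) → ℝ, ({t | t ∈ I ∧ ∑ k, g k * f k t = 0}.encard : ℝ≥0∞)
        ∂(Measure.pi fun _ => gaussianReal 0 1) =
      ∫⁻ t in I, ENNReal.ofReal (√(∑ k, deriv (f k) t ^ 2) / π) := by
  let P : Fin (n + 1) → Set ℝ := fun i => I ∩ disjointed (fun k => {t | f k t ≠ 0}) i
  have hne : ∀ k, MeasurableSet {t | f k t ≠ 0} := fun k =>
    (isOpen_ne_fun (hf k).continuous continuous_const).measurableSet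
  have hPm : ∀ i, MeasurableSet (P i) := fun i =>
    hI.inter (disjointedRec (fun _ k h => h.diff (hne k)) (hne i))
  have hPd : Pairwise (Function.onFun Disjoint P) := fun i j hij =>
    (disjoint_disjointed _ hij).mono inter_subset_right inter_subset_right
  have hPI : I = ⋃ i, P i := by
    rw [← inter_iUnion, iUnion_disjointed, eq_comm, inter_eq_left]
    intro t _
    by_contra h
    have h0 : ∀ k, f k t = 0 := by simpa using h
    simpa [h0] using hf1 t
  have hP0 : ∀ i, ∀ t ∈ P i, f i t ≠ 0 := fun i t ht => disjointed_subset _ i ht.2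
  have key := fun i => aemeasurable_and_lintegral_encard_zeros_of_ne_zero hf hf1 (hPm i) i (hP0 i)
  have hcount : ∀ g : Fin (n + 1) → ℝ, ({t | t ∈ I ∧ ∑ k, g k * f k t = 0}.encard : ℝ≥0∞) =
      ∑ i, ({t | t ∈ P i ∧ ∑ k, g k * f k t = 0}.encard : ℝ≥0∞) := by
    intro g
    have hZ : MeasurableSet {t | ∑ k, g k * f k t = 0} :=
      (isClosed_eq (continuous_finsetSum _ fun k _ => continuous_const.mul (hf k).continuous)
        continuous_const).measurableSet
    have h : ∀ A : Set ℝ, MeasurableSet A → ({t | t ∈ A ∧ ∑ k, g k * f k t = 0}.encard : ℝ≥0∞) =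
        Measure.count (A ∩ {t | ∑ k, g k * f k t = 0}) := fun A hA =>
      (Measure.count_apply (hA.inter hZ)).symm
    rw [h I hI]
    simp_rw [fun i => h (P i) (hPm i)]
    rw [hPI, iUnion_inter, measure_iUnion _ fun i => (hPm i).inter hZ, tsum_fintype]
    exact fun i j hij => (hPd hij).mono inter_subset_left inter_subset_left
  simp_rw [hcount]
  rw [lintegral_finsetSum' _ fun i _ => (key i).1]
  simp_rw [fun i => (key i).2]
  rw [hPI, lintegral_iUnion hPm hPd, tsum_fintype]

end UnitCurve

/-- Theorem 3.1 (central normal coefficients, identity covariance after the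
substitution `w = C^{1/2} v`): the expected number of solutions in a measurable set `I`
of `g₀ w₀(t) + ⋯ + gₙ wₙ(t) = 0`, with `g` a vector of iid standard normals, equals
`(1/π) ∫_I ‖γ'(t)‖ dt` where `γ = w/‖w‖`. -/
theorem expected_zeros_central_normal (n : ℕ)
    (w : ℝ → EuclideanSpace ℝ (Fin (n + 1)))
    (hw : Differentiable ℝ w) (hw0 : ∀ t, w t ≠ 0)
    (γ : ℝ → EuclideanSpace ℝ (Fin (n + 1)))
    (hγ : ∀ t, γ t = ‖w t‖⁻¹ • w t)
    (I : Set ℝ) (hI : MeasurableSet I) :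
    ∫⁻ g : Fin (n + 1) → ℝ,
        ({t : ℝ | t ∈ I ∧ ∑ i : Fin (n + 1), g i * w t i = 0}.encard : ℝ≥0∞)
        ∂(Measure.pi fun _ => gaussianReal 0 1)
      = (∫⁻ t in I, ENNReal.ofReal ‖deriv γ t‖) / ENNReal.ofReal π := by
  have hγd : Differentiable ℝ γ := by
    rw [funext hγ]
    exact (hw.norm ℝ hw0).inv (fun t => norm_ne_zero_iff.2 (hw0 t)) |>.smul hw
  have hcoord : ∀ k t, HasDerivAt (fun s => γ s k) (deriv γ t k) t := fun k t =>
    (EuclideanSpace.proj k : _ →L[ℝ] ℝ).hasFDerivAt.comp_hasDerivAt t (hγd t).hasDerivAt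
  have hunit : ∀ t, ∑ k, γ t k ^ 2 = 1 := fun t => by
    rw [← EuclideanSpace.real_norm_sq_eq, hγ, norm_smul, norm_inv, norm_norm,
      inv_mul_cancel₀ (norm_ne_zero_iff.2 (hw0 t)), one_pow]
  have hzero : ∀ (g : Fin (n + 1) → ℝ) t, ∑ k, g k * w t k = 0 ↔ ∑ k, g k * γ t k = 0 := by
    intro g t
    have h : ∑ k, g k * γ t k = ‖w t‖⁻¹ * ∑ k, g k * w t k := by
      rw [hγ, Finset.mul_sum]
      refine Finset.sum_congr rfl fun k _ => ?_
      rw [PiLp.smul_apply, smul_eq_mul]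
      ring
    rw [h, mul_eq_zero, or_iff_right (inv_ne_zero (norm_ne_zero_iff.2 (hw0 t)))]
  simp_rw [hzero]
  rw [lintegral_encard_zeros_of_sum_sq_eq_one (f := fun k t => γ t k)
    (fun k t => (hcoord k t).differentiableAt) hunit hI, div_eq_mul_inv,
    ← lintegral_mul_const _ (measurable_deriv γ).norm.ennreal_ofReal]
  refine lintegral_congr fun t => ?_
  simp_rw [fun k => (hcoord k t).deriv]
  rw [← EuclideanSpace.real_norm_sq_eq, Real.sqrt_sq (norm_nonneg _),
    ENNReal.ofReal_div_of_pos pi_pos, div_eq_mul_inv]
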